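/- Fix integers n ≥ 1 and m ≥ 2. Let b be a b-cocycle of L_{n,m}. Then for every 1 ≤ i ≤ m, the coordinate of b(Y_i, Y_i) on the basis vector X_0 (with respect to the basis X_0, X_1, …, X_n of V0) is zero. -/

import Mathlib

open Finset

noncomputable section

/-- The even part of `L_{n,m}`: `ℂ^{n+1}` with basis `X_0, …, X_n`. -/
abbrev V0 (n : ℕ) : Type := Fin (n + 1) → ℂ

/-- The odd part of `L_{n,m}`: `ℂ^m` with basis `Y_1, …, Y_m`. -/
abbrev V1 (m : ℕ) : Type := Fin m → ℂ

/-- Basis vector `X_k` of `V0 n` for `0 ≤ k ≤ n`; zero for `k > n`. -/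
def Xb (n k : ℕ) : V0 n := if h : k ≤ n then Pi.single (⟨k, by omega⟩ : Fin (n + 1)) 1 else 0

/-- `X_k`, with the convention that it denotes the zero vector for `k ≤ 0` or `k > n`. -/
def Xz (n : ℕ) (k : ℤ) : V0 n :=
  if h : 1 ≤ k ∧ k ≤ n then Pi.single (⟨k.toNat, by omega⟩ : Fin (n + 1)) 1 else 0

/-- Basis vector `Y_k` of `V1 m` for `1 ≤ k ≤ m`; zero otherwise. -/
def Yb (m k : ℕ) : V1 m :=
  if h : 1 ≤ k ∧ k ≤ m then Pi.single (⟨k - 1, by omega⟩ : Fin m) 1 else 0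

/-- The bilinear map determined by its values on the standard bases. -/
def bil {ι κ : Type} [Fintype ι] [DecidableEq ι] [Fintype κ] [DecidableEq κ]
    {M : Type} [AddCommGroup M] [Module ℂ M] (f : ι → κ → M) :
    (ι → ℂ) →ₗ[ℂ] (κ → ℂ) →ₗ[ℂ] M :=
  LinearMap.mk₂ ℂ (fun x y => ∑ i, ∑ j, (x i * y j) • f i j)
    (fun x x' y => by simp [add_mul, add_smul, Finset.sum_add_distrib])
    (fun c x y => by simp [Finset.smul_sum, mul_assoc, mul_smul])
    (fun x y y' => by simp [mul_add, add_smul, Finset.sum_add_distrib])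
    (fun c x y => by simp [Finset.smul_sum, mul_smul, mul_left_comm])

/-- The bracket `μ0` of `L_{n,m}` on the even part. -/
def mu0 (n : ℕ) : V0 n →ₗ[ℂ] V0 n →ₗ[ℂ] V0 n :=
  bil fun i j =>
    if (i : ℕ) = 0 ∧ 1 ≤ (j : ℕ) then Xz n (((j : ℕ) : ℤ) + 1)
    else if (j : ℕ) = 0 ∧ 1 ≤ (i : ℕ) then -Xz n (((i : ℕ) : ℤ) + 1)
    else 0

/-- The bracket `ρ0` of `L_{n,m}` between the even and the odd part. -/
def rho0 (n m : ℕ) : V0 n →ₗ[ℂ] V1 m →ₗ[ℂ] V1 m :=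
  bil fun i j => if (i : ℕ) = 0 then Yb m ((j : ℕ) + 2) else 0


/-- Pinned instance for the space of bilinear maps `V0 × V1 → V1`. -/
instance (priority := 5000) instAddCommGroupBilRho (n m : ℕ) :
    AddCommGroup (V0 n →ₗ[ℂ] V1 m →ₗ[ℂ] V1 m) := LinearMap.addCommGroup

/-- Pinned instance for the space of bilinear maps `V0 × V1 → V1`. -/
instance (priority := 5000) instModuleBilRho (n m : ℕ) :
    Module ℂ (V0 n →ₗ[ℂ] V1 m →ₗ[ℂ] V1 m) := LinearMap.module

/-- Pinned instance for the space of bilinear maps `V1 × V1 → V0`. -/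
instance (priority := 5000) instAddCommGroupBilB (n m : ℕ) :
    AddCommGroup (V1 m →ₗ[ℂ] V1 m →ₗ[ℂ] V0 n) := LinearMap.addCommGroup

/-- Pinned instance for the space of bilinear maps `V1 × V1 → V0`. -/
instance (priority := 5000) instModuleBilB (n m : ℕ) :
    Module ℂ (V1 m →ₗ[ℂ] V1 m →ₗ[ℂ] V0 n) := LinearMap.module
/-- `ρ` is a ρ-cocycle of `L_{n,m}`. -/
def IsRhoCocycle (n m : ℕ) (ρ : V0 n →ₗ[ℂ] V1 m →ₗ[ℂ] V1 m) : Prop :=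
  ∀ (g g' : V0 n) (h : V1 m),
    ρ (mu0 n g g') h + ρ g' (rho0 n m g h) - ρ g (rho0 n m g' h)
      - rho0 n m g (ρ g' h) + rho0 n m g' (ρ g h) = 0

/-- `b` is a b-cocycle of `L_{n,m}` : it is symmetric and satisfies (R1) and (R2). -/
def IsBCocycle (n m : ℕ) (b : V1 m →ₗ[ℂ] V1 m →ₗ[ℂ] V0 n) : Prop :=
  (∀ h h', b h h' = b h' h) ∧
  (∀ (g : V0 n) (h h' : V1 m),
    b (rho0 n m g h) h' + b (rho0 n m g h') h - mu0 n g (b h h') = 0) ∧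
  (∀ h h' h'' : V1 m,
    rho0 n m (b h h') h'' + rho0 n m (b h'' h') h + rho0 n m (b h'' h) h' = 0)

/-- `b` satisfies relation (R3). -/
def SatR3 (n m : ℕ) (b : V1 m →ₗ[ℂ] V1 m →ₗ[ℂ] V0 n) : Prop :=
  ∀ t r : ℕ, 1 ≤ t → t ≤ m - 1 → 1 ≤ r → r ≤ m - 1 →
    mu0 n (Xb n 0) (b (Yb m t) (Yb m r)) = b (Yb m (t + 1)) (Yb m r) + b (Yb m (r + 1)) (Yb m t)

/-- Membership in the space `E`: symmetric, satisfies (R3), and `b(Y_m,Y_m) ∈ ℂ·X_n`. -/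
def MemE (n m : ℕ) (b : V1 m →ₗ[ℂ] V1 m →ₗ[ℂ] V0 n) : Prop :=
  (∀ h h', b h h' = b h' h) ∧ SatR3 n m b ∧ ∃ c : ℂ, b (Yb m m) (Yb m m) = c • Xb n n

lemma rho0_Yb (n m i : ℕ) (hi : 1 ≤ i) (him : i ≤ m) (g : V0 n) :
    rho0 n m g (Yb m i) = g 0 • Yb m (i + 1) := by
  have hi2 : i - 1 + 2 = i + 1 := by omega
  rw [Yb, dif_pos ⟨hi, him⟩]
  simp only [rho0, bil, LinearMap.mk₂_apply]
  rw [Finset.sum_eq_single 0, Finset.sum_eq_single ⟨i - 1, by omega⟩]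
  · simp [hi2]
  · intro j _ hj
    simp [Pi.single_eq_of_ne hj]
  · simp
  · intro k _ hk
    have hk0 : (k : ℕ) ≠ 0 := fun h => hk (Fin.ext h)
    simp [hk0]
  · simp

lemma Xz_apply_zero (n : ℕ) (k : ℤ) : Xz n k 0 = 0 := by
  unfold Xz
  split_ifs with h
  · refine Pi.single_eq_of_ne (fun h0 => ?_) _
    have := congrArg Fin.val h0
    simp only [Fin.val_zero] at this
    omega
  · rfl

lemma mu0_apply_zero (n : ℕ) (g g' : V0 n) : mu0 n g g' 0 = 0 := by
  simp only [mu0, bil, LinearMap.mk₂_apply, Finset.sum_apply, Pi.smul_apply]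
  refine Finset.sum_eq_zero fun i _ => Finset.sum_eq_zero fun j _ => ?_
  split_ifs <;> simp [Xz_apply_zero]

lemma Yb_ne_zero {m k : ℕ} (hk : 1 ≤ k) (hkm : k ≤ m) : Yb m k ≠ 0 := by
  simp [Yb, hk, hkm]

lemma Yb_eq_zero_of_lt {m k : ℕ} (hk : m < k) : Yb m k = 0 :=
  dif_neg fun h => by omega

/-- For a b-cocycle `b` of `L_{n,m}` (with `m ≥ 2`), the coordinate of `b(Y_i, Y_i)` on
the basis vector `X_0` vanishes. -/
theorem bCocycle_diag_has_no_X0_component (n m : ℕ) (hn : 1 ≤ n) (hm : 2 ≤ m)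
    (b : V1 m →ₗ[ℂ] V1 m →ₗ[ℂ] V0 n) (hb : IsBCocycle n m b) :
    ∀ i : ℕ, 1 ≤ i → i ≤ m → b (Yb m i) (Yb m i) (0 : Fin (n + 1)) = 0 := by
  obtain ⟨-, hR1, hR2⟩ := hb
  intro i hi him
  rcases him.lt_or_eq with hlt | rfl
  · have h := hR2 (Yb m i) (Yb m i) (Yb m i)
    rw [rho0_Yb n m i hi him, ← add_smul, ← add_smul, smul_eq_zero] at h
    have h3 := h.resolve_right (Yb_ne_zero (by omega) hlt)
    linear_combination h3 / 3
  · have h := hR1 (Xb n 0) (Yb i (i - 1)) (Yb i i)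
    rw [rho0_Yb n i (i - 1) (by omega) (by omega), rho0_Yb n i i hi le_rfl,
      Yb_eq_zero_of_lt (Nat.lt_succ_self i), Nat.sub_add_cancel hi] at h
    have h0 := congrFun h 0
    simpa [mu0_apply_zero, Xb] using h0

end
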